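/- Let n ≥ 1, α ∈ (−1,1), let v : ℝⁿ → ℝ be bounded and of class C¹, and set c_{n,α} := ( ∫_{ℝⁿ} (1+|y|²)^{−(n+1−α)/2} dy )^{−1} and u(y,x) := c_{n,α} ∫_{ℝⁿ} x^{1−α} (x² + |y−z|²)^{−(n+1−α)/2} v(z) dz for y ∈ ℝⁿ, x > 0. Then for every y ∈ ℝⁿ the map x ↦ u(y,x) is differentiable on (0,∞) and, for every x > 0, x^α ∂_x u(y,x) = c_{n,α} ∫_{ℝⁿ} [ (1−α)|ξ|² − n x² ] ( v(y−ξ) − v(y) ) (x² + |ξ|²)^{−(n+3−α)/2} dξ, the integral on the right being absolutely convergent. -/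

import Mathlib

open MeasureTheory Metric Set
open scoped Topology

noncomputable section

/-- The (unnormalized) Poisson kernel
`P(y,x) = x^{1−α} (x² + |y|²)^{−(n+1−α)/2}` of the operator `div(x^α ∇·)`. -/
def P (n : ℕ) (α : ℝ) (y : EuclideanSpace ℝ (Fin n)) (x : ℝ) : ℝ :=
  x ^ (1 - α) * (x ^ 2 + ‖y‖ ^ 2) ^ (-(((n : ℝ) + 1 - α) / 2))

/-- The normalizing constant `c_{n,α}`. -/
def cnα (n : ℕ) (α : ℝ) : ℝ :=
  (∫ y : EuclideanSpace ℝ (Fin n), (1 + ‖y‖ ^ 2) ^ (-(((n : ℝ) + 1 - α) / 2)))⁻¹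

theorem rpow_poisson_exponent_succ {s : ℝ} (hs : 0 < s) (n : ℕ) (α : ℝ) :
    s ^ (-(((n : ℝ) + 1 - α) / 2)) = s * s ^ (-(((n : ℝ) + 3 - α) / 2)) := by
  nth_rewrite 2 [← Real.rpow_one s]
  rw [← Real.rpow_add hs]
  congr 1
  ring

/-- The derivative of the Poisson kernel in the extension variable. -/
def poissonKernelDeriv (n : ℕ) (α : ℝ) (ξ : EuclideanSpace ℝ (Fin n)) (x : ℝ) : ℝ :=
  x ^ (-α) * (((1 - α) * ‖ξ‖ ^ 2 - (n : ℝ) * x ^ 2) *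
    (x ^ 2 + ‖ξ‖ ^ 2) ^ (-(((n : ℝ) + 3 - α) / 2)))

theorem hasDerivAt_poissonKernel (n : ℕ) (α : ℝ) (ξ : EuclideanSpace ℝ (Fin n)) {x : ℝ}
    (hx : 0 < x) : HasDerivAt (P n α ξ) (poissonKernelDeriv n α ξ x) x := by
  have hpos : 0 < x ^ 2 + ‖ξ‖ ^ 2 := by positivity
  have h₁ : HasDerivAt (fun t : ℝ => t ^ (1 - α)) ((1 - α) * x ^ (1 - α - 1)) x :=
    Real.hasDerivAt_rpow_const (Or.inl hx.ne')
  have h₂ : HasDerivAt (fun t : ℝ => t ^ 2 + ‖ξ‖ ^ 2) (2 * x) x := by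
    simpa using (hasDerivAt_pow 2 x).add_const (‖ξ‖ ^ 2)
  have h₃ := h₂.rpow_const (p := -(((n : ℝ) + 1 - α) / 2)) (Or.inl hpos.ne')
  refine (h₁.mul h₃).congr_deriv ?_
  have e₁ : x ^ (1 - α - 1) = x ^ (-α) := by congr 1; ring
  have e₂ : x ^ (1 - α) = x * x ^ (-α) := by
    rw [sub_eq_add_neg, Real.rpow_add hx, Real.rpow_one]
  have e₄ : -(((n : ℝ) + 1 - α) / 2) - 1 = -(((n : ℝ) + 3 - α) / 2) := by ring
  rw [e₁, e₂, e₄, rpow_poisson_exponent_succ hpos, poissonKernelDeriv]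
  ring

theorem rpow_sq_add_norm_sq_le {E : Type*} [SeminormedAddCommGroup E] {a t p : ℝ} (ha : 0 < a)
    (hat : a ≤ t) (hp : p ≤ 0) (ξ : E) :
    (t ^ 2 + ‖ξ‖ ^ 2) ^ p ≤ min 1 (a ^ 2) ^ p * (1 + ‖ξ‖ ^ 2) ^ p := by
  have hm : 0 < min 1 (a ^ 2) := by positivity
  rw [← Real.mul_rpow hm.le (by positivity)]
  refine Real.rpow_le_rpow_of_nonpos (by positivity) ?_ hp
  have h₁ : min 1 (a ^ 2) ≤ t ^ 2 := (min_le_right _ _).trans (by gcongr)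
  have h₂ : min 1 (a ^ 2) * ‖ξ‖ ^ 2 ≤ 1 * ‖ξ‖ ^ 2 := by gcongr; exact min_le_left _ _
  linarith

theorem abs_poissonKernelDeriv_le {n : ℕ} {α : ℝ} (hα : α < 1) (ξ : EuclideanSpace ℝ (Fin n))
    {t : ℝ} (ht : 0 < t) :
    |poissonKernelDeriv n α ξ t| ≤
      t ^ (-α) * ((1 - α + n) * (t ^ 2 + ‖ξ‖ ^ 2) ^ (-(((n : ℝ) + 1 - α) / 2))) := by
  have hpos : 0 < t ^ 2 + ‖ξ‖ ^ 2 := by positivity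
  have hn : (0 : ℝ) ≤ n := n.cast_nonneg
  rw [poissonKernelDeriv, abs_mul, abs_mul, abs_of_pos (Real.rpow_pos_of_pos ht _),
    abs_of_pos (Real.rpow_pos_of_pos hpos _),
    rpow_poisson_exponent_succ hpos, ← mul_assoc (1 - α + (n : ℝ))]
  gcongr
  rw [abs_le]
  have h₁ : 0 ≤ (1 - α) * ‖ξ‖ ^ 2 := mul_nonneg (by linarith) (by positivity)
  have h₂ : 0 ≤ (1 - α) * t ^ 2 := mul_nonneg (by linarith) (by positivity)
  have h₃ : 0 ≤ n * ‖ξ‖ ^ 2 := by positivity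
  have h₄ : 0 ≤ n * t ^ 2 := by positivity
  constructor <;> linarith

theorem integrable_poissonProfile (n : ℕ) {α : ℝ} (hα : α < 1) :
    Integrable fun ξ : EuclideanSpace ℝ (Fin n) =>
      (1 + ‖ξ‖ ^ 2) ^ (-(((n : ℝ) + 1 - α) / 2)) := by
  have h := integrable_rpow_neg_one_add_norm_sq (E := EuclideanSpace ℝ (Fin n))
    (μ := volume) (r := (n : ℝ) + 1 - α) (by simp; linarith)
  simpa only [neg_div] using h

theorem measurable_poissonKernel (n : ℕ) (α x : ℝ) : Measurable fun ξ => P n α ξ x := by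
  unfold P
  fun_prop

theorem measurable_poissonKernelDeriv (n : ℕ) (α x : ℝ) :
    Measurable fun ξ => poissonKernelDeriv n α ξ x := by
  unfold poissonKernelDeriv
  fun_prop

theorem integrable_poissonKernel (n : ℕ) {α x : ℝ} (hα : α < 1) (hx : 0 < x) :
    Integrable fun ξ => P n α ξ x := by
  have hn : (0 : ℝ) ≤ n := n.cast_nonneg
  refine (((integrable_poissonProfile n hα).const_mul
    (min 1 (x ^ 2) ^ (-(((n : ℝ) + 1 - α) / 2)))).const_mul (x ^ (1 - α))).mono'
    (measurable_poissonKernel n α x).aestronglyMeasurable (.of_forall fun ξ => ?_)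
  rw [P, Real.norm_of_nonneg (by positivity)]
  gcongr
  exact rpow_sq_add_norm_sq_le hx le_rfl (by linarith) ξ

/-- Differentiation under the integral sign for the Poisson kernel against a bounded density. -/
theorem hasDerivAt_integral_poissonKernel_mul {n : ℕ} {α x M : ℝ} (hα : α < 1) (hx : 0 < x)
    {w : EuclideanSpace ℝ (Fin n) → ℝ} (hw : Measurable w) (hM : ∀ ξ, |w ξ| ≤ M) :
    Integrable (fun ξ => poissonKernelDeriv n α ξ x * w ξ) ∧
      HasDerivAt (fun t => ∫ ξ, P n α ξ t * w ξ) (∫ ξ, poissonKernelDeriv n α ξ x * w ξ) x := by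
  have hn : (0 : ℝ) ≤ n := n.cast_nonneg
  have hs : Ioo (x / 2) (2 * x) ∈ 𝓝 x := Ioo_mem_nhds (by linarith) (by linarith)
  refine hasDerivAt_integral_of_dominated_loc_of_deriv_le (F := fun t ξ => P n α ξ t * w ξ)
    (F' := fun t ξ => poissonKernelDeriv n α ξ t * w ξ)
    (bound := fun ξ => (2 * x) ^ (1 - α) * (x / 2)⁻¹ * ((1 - α + n) *
      (min 1 ((x / 2) ^ 2) ^ (-(((n : ℝ) + 1 - α) / 2)) *
        (1 + ‖ξ‖ ^ 2) ^ (-(((n : ℝ) + 1 - α) / 2)))) * M) hs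
    (.of_forall fun t => ((measurable_poissonKernel n α t).mul hw).aestronglyMeasurable)
    ((integrable_poissonKernel n hα hx).mul_bdd hw.aestronglyMeasurable (.of_forall hM))
    ((measurable_poissonKernelDeriv n α x).mul hw).aestronglyMeasurable
    (.of_forall fun ξ t ht => ?_)
    (((((integrable_poissonProfile n hα).const_mul _).const_mul _).const_mul _).mul_const _)
    (.of_forall fun ξ t ht => ?_)
  · have ht₀ : 0 < t := by linarith [ht.1]
    rw [norm_mul, Real.norm_eq_abs, Real.norm_eq_abs]
    have hα' : 0 ≤ 1 - α + n := by linarith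
    have hpow : t ^ (-α) ≤ (2 * x) ^ (1 - α) * (x / 2)⁻¹ := by
      have : t ^ (-α) = t ^ (1 - α) * t⁻¹ := by
        rw [← Real.rpow_neg_one, ← Real.rpow_add ht₀]; congr 1; ring
      rw [this]
      have h₁ := ht.1
      have h₂ := ht.2
      gcongr
    have hbase := rpow_sq_add_norm_sq_le (p := -(((n : ℝ) + 1 - α) / 2))
      (half_pos hx) ht.1.le (by linarith) ξ
    refine mul_le_mul ((abs_poissonKernelDeriv_le hα ξ ht₀).trans ?_) (hM ξ) (abs_nonneg _)
      (by positivity)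
    gcongr
  · exact (hasDerivAt_poissonKernel n α ξ (by linarith [ht.1])).mul_const _

/-- The total mass of the Poisson kernel does not depend on the extension variable. -/
theorem integral_poissonKernel (n : ℕ) (α : ℝ) {x : ℝ} (hx : 0 < x) :
    ∫ ξ, P n α ξ x =
      ∫ ξ : EuclideanSpace ℝ (Fin n), (1 + ‖ξ‖ ^ 2) ^ (-(((n : ℝ) + 1 - α) / 2)) := by
  have h := Measure.integral_comp_smul (volume : Measure (EuclideanSpace ℝ (Fin n)))
    (fun ξ => P n α ξ x) x
  have hscale : ∀ ξ : EuclideanSpace ℝ (Fin n), P n α (x • ξ) x =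
      (x ^ n)⁻¹ * (1 + ‖ξ‖ ^ 2) ^ (-(((n : ℝ) + 1 - α) / 2)) := by
    intro ξ
    have e : x ^ 2 + ‖x • ξ‖ ^ 2 = x ^ 2 * (1 + ‖ξ‖ ^ 2) := by
      rw [norm_smul, Real.norm_of_nonneg hx.le]; ring
    rw [P, e, Real.mul_rpow (by positivity) (by positivity), ← mul_assoc]
    congr 1
    rw [← Real.rpow_natCast x 2, ← Real.rpow_mul hx.le, ← Real.rpow_add hx,
      ← Real.rpow_natCast x n, ← Real.rpow_neg hx.le]
    congr 1
    push_cast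
    ring
  have hxn : 0 < (x ^ n)⁻¹ := by positivity
  simp_rw [hscale, integral_const_mul, finrank_euclideanSpace_fin, abs_of_pos hxn,
    smul_eq_mul] at h
  exact (mul_left_cancel₀ hxn.ne' h).symm

theorem integral_poissonKernelDeriv (n : ℕ) {α x : ℝ} (hα : α < 1) (hx : 0 < x) :
    Integrable (fun ξ => poissonKernelDeriv n α ξ x) ∧ ∫ ξ, poissonKernelDeriv n α ξ x = 0 := by
  have h := hasDerivAt_integral_poissonKernel_mul (n := n) (w := fun _ => 1) (M := 1) hα hx
    measurable_const (by simp)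
  simp only [mul_one] at h
  refine ⟨h.1, h.2.unique ((hasDerivAt_const x
    (∫ ξ : EuclideanSpace ℝ (Fin n), (1 + ‖ξ‖ ^ 2) ^ (-(((n : ℝ) + 1 - α) / 2)))).congr_of_eventuallyEq ?_)⟩
  filter_upwards [Ioi_mem_nhds hx] with t ht
  exact integral_poissonKernel n α ht

/-- Lemma 4.2, first part: for the Poisson extension `u` of a bounded `C¹` function
`v`, the map `x ↦ u(y,x)` is differentiable on `(0,∞)` and
`x^α ∂ₓu(y,x) = c_{n,α} ∫ [(1-α)|ξ|² - nx²](v(y-ξ) - v(y))(x²+|ξ|²)^{-(n+3-α)/2} dξ`,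
the integral on the right being absolutely convergent. -/
theorem poisson_extension_flux
    (n : ℕ) (hn : 1 ≤ n) (α : ℝ) (hα : α ∈ Ioo (-1:ℝ) 1)
    (v : EuclideanSpace ℝ (Fin n) → ℝ)
    (hv : ContDiff ℝ 1 v) (hvb : ∃ M : ℝ, ∀ z, |v z| ≤ M)
    (u : EuclideanSpace ℝ (Fin n) → ℝ → ℝ)
    (hu : ∀ y x, u y x = cnα n α * ∫ z : EuclideanSpace ℝ (Fin n), P n α (y - z) x * v z) :
    ∀ (y : EuclideanSpace ℝ (Fin n)) (x : ℝ), 0 < x →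
      DifferentiableAt ℝ (u y) x ∧
      (Integrable fun ξ : EuclideanSpace ℝ (Fin n) =>
        ((1 - α) * ‖ξ‖ ^ 2 - (n : ℝ) * x ^ 2) * (v (y - ξ) - v y) *
          (x ^ 2 + ‖ξ‖ ^ 2) ^ (-(((n : ℝ) + 3 - α) / 2))) ∧
      x ^ α * deriv (u y) x =
        cnα n α * ∫ ξ : EuclideanSpace ℝ (Fin n),
          ((1 - α) * ‖ξ‖ ^ 2 - (n : ℝ) * x ^ 2) * (v (y - ξ) - v y) *
            (x ^ 2 + ‖ξ‖ ^ 2) ^ (-(((n : ℝ) + 3 - α) / 2)) := by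
  intro y x hx
  obtain ⟨M, hM⟩ := hvb
  obtain ⟨hint, hder⟩ := hasDerivAt_integral_poissonKernel_mul (w := fun ξ => v (y - ξ)) hα.2 hx
    (hv.continuous.measurable.comp (measurable_const.sub measurable_id)) (fun ξ => hM _)
  obtain ⟨hint₀, hzero⟩ := integral_poissonKernelDeriv n hα.2 hx
  have hu' : u y = fun t => cnα n α * ∫ ξ, P n α ξ t * v (y - ξ) := by
    ext t
    rw [hu, ← integral_sub_left_eq_self (fun z => P n α (y - z) t * v z) volume y]
    simp
  have hderu : HasDerivAt (u y) (cnα n α * ∫ ξ, poissonKernelDeriv n α ξ x * v (y - ξ)) x := by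
    rw [hu']
    exact hder.const_mul _
  have hxα : x ^ α * x ^ (-α) = 1 := by rw [← Real.rpow_add hx, add_neg_cancel, Real.rpow_zero]
  have hflux : (fun ξ : EuclideanSpace ℝ (Fin n) =>
      ((1 - α) * ‖ξ‖ ^ 2 - (n : ℝ) * x ^ 2) * (v (y - ξ) - v y) *
        (x ^ 2 + ‖ξ‖ ^ 2) ^ (-(((n : ℝ) + 3 - α) / 2))) = fun ξ =>
      x ^ α * (poissonKernelDeriv n α ξ x * v (y - ξ) - poissonKernelDeriv n α ξ x * v y) := by
    ext ξ
    rw [poissonKernelDeriv]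
    linear_combination (-(((1 - α) * ‖ξ‖ ^ 2 - (n : ℝ) * x ^ 2) * (v (y - ξ) - v y) *
      (x ^ 2 + ‖ξ‖ ^ 2) ^ (-(((n : ℝ) + 3 - α) / 2)))) * hxα
  refine ⟨hderu.differentiableAt, ?_, ?_⟩
  · rw [hflux]
    exact (hint.sub (hint₀.mul_const _)).const_mul _
  · rw [hflux, hderu.deriv, integral_const_mul, integral_sub hint (hint₀.mul_const _),
      integral_mul_const, hzero]
    ring
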